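/- Let S be a finite set of cubes in ℝ^d and for each Q0 ∈ S let D(Q0) be a set of cubes contained in Q0; set D = ∪_{Q0∈S} D(Q0) and assume no cube in S is strictly contained in a cube in D. Then for every ε ∈ (0,1) there exist constants C, C₁, C₂ depending only on ε and d, and a subset F ⊂ D, such that: (i) for every x ∈ ℝ^d there are at most C cubes Q ∈ F with x ∈ (1−ε)²Q; (ii) for every Q0 ∈ S and every Q ∈ D(Q0) there exists a cube P ∈ F with Q ⊂ C₁P and P ⊂ C₂Q0. -/

import Mathlib

open MeasureTheory Metric Set Filter
open scoped ENNReal NNReal Topology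

noncomputable section

/-- Euclidean space `ℝ^d`. -/
abbrev Euc (d : ℕ) := EuclideanSpace ℝ (Fin d)

/-- The divergence of a vector field `φ : ℝ^d → ℝ^d`. -/
def diverg (d : ℕ) (φ : Euc d → Euc d) (x : Euc d) : ℝ :=
  ∑ i : Fin d, fderiv ℝ φ x (EuclideanSpace.single i 1) i

/-- The variation of `f` on an open set `Ω`:
`var_Ω f = sup { ∫_Ω f div φ : φ ∈ C_c^1(Ω; ℝ^d), |φ| ≤ 1 }`. -/
def variation (d : ℕ) (Ω : Set (Euc d)) (f : Euc d → ℝ) : ℝ≥0∞ :=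
  ⨆ (φ : Euc d → Euc d) (_ : ContDiff ℝ 1 φ) (_ : HasCompactSupport φ)
    (_ : tsupport φ ⊆ Ω) (_ : ∀ x, ‖φ x‖ ≤ 1),
    ENNReal.ofReal (∫ x in Ω, f x * diverg d φ x)

/-- `Q` is a cube of side length `l`: the image of `(0,1)^d` scaled by `l`,
rotated and translated. -/
def IsCubeOfSide (d : ℕ) (l : ℝ) (Q : Set (Euc d)) : Prop :=
  0 < l ∧ ∃ (r : Euc d ≃ₗᵢ[ℝ] Euc d) (v : Euc d),
    Q = (fun x => l • r x + v) '' {x : Euc d | ∀ i, x i ∈ Set.Ioo (0:ℝ) 1}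

/-- `Q` is a cube (of some positive side length, arbitrary orientation). -/
def IsCube (d : ℕ) (Q : Set (Euc d)) : Prop := ∃ l, IsCubeOfSide d l Q

/-- The side length of a cube, recovered from its volume. -/
def sideLength (d : ℕ) (Q : Set (Euc d)) : ℝ := (volume Q).toReal ^ ((d:ℝ)⁻¹)

/-- The center of a cube, recovered as its barycenter. -/
def cubeCenter (d : ℕ) (Q : Set (Euc d)) : Euc d := (volume Q).toReal⁻¹ • ∫ x in Q, x

/-- The dilate `KQ = {c_Q + K r : c_Q + r ∈ Q}` of a cube `Q` about its center. -/
def dilate (d : ℕ) (K : ℝ) (Q : Set (Euc d)) : Set (Euc d) :=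
  {y | ∃ x ∈ Q, y = cubeCenter d Q + K • (x - cubeCenter d Q)}

/-- `Q ∈ Δ(Q0)`: `Q` is a dyadic subcube of the cube `Q0`, i.e. the image under the
affine bijection mapping `(0,1)^d` onto `Q0` of a dyadic subcube of `(0,1)^d`. -/
def IsDyadicOf (d : ℕ) (Q Q0 : Set (Euc d)) : Prop :=
  ∃ (l : ℝ) (r : Euc d ≃ₗᵢ[ℝ] Euc d) (v : Euc d), 0 < l ∧
    Q0 = (fun x => l • r x + v) '' {x : Euc d | ∀ i, x i ∈ Set.Ioo (0:ℝ) 1} ∧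
    ∃ (n : ℕ) (k : Fin d → ℕ), (∀ i, k i < 2 ^ n) ∧
      Q = (fun x => l • r x + v) ''
        {x : Euc d | ∀ i, x i ∈ Set.Ioo ((k i : ℝ) / 2 ^ n) (((k i : ℝ) + 1) / 2 ^ n)}

/-- A set of cubes is dyadically complete if for all `Q0, P` in it with `P ⊆ Q0`,
every dyadic cube `Q ∈ Δ(Q0)` with `P ⊆ Q` also belongs to it. -/
def DyadicComplete (d : ℕ) (𝒬 : Set (Set (Euc d))) : Prop :=
  ∀ Q0 ∈ 𝒬, ∀ P ∈ 𝒬, P ⊆ Q0 → ∀ Q, IsDyadicOf d Q Q0 → P ⊆ Q → Q ∈ 𝒬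

/-- The measure theoretic closure `cl* E = {x : limsup_{r→0} |B(x,r)∩E|/r^d > 0}`. -/
def mClosure (d : ℕ) (E : Set (Euc d)) : Set (Euc d) :=
  {x | 0 < Filter.limsup (fun r : ℝ => volume (Metric.ball x r ∩ E) / ENNReal.ofReal (r ^ d))
      (nhdsWithin 0 (Set.Ioi 0))}

/-- The measure theoretic boundary `∂* E = cl* E ∩ cl* (Eᶜ)`. -/
def mBoundary (d : ℕ) (E : Set (Euc d)) : Set (Euc d) := mClosure d E ∩ mClosure d Eᶜ

/-- `E` has locally finite perimeter: the variation of its indicator function is finite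
on every bounded open set. -/
def HasLocallyFinitePerimeter (d : ℕ) (E : Set (Euc d)) : Prop :=
  ∀ V : Set (Euc d), IsOpen V → Bornology.IsBounded V →
    variation d V (Set.indicator E fun _ => (1:ℝ)) < ⊤

/-- The integral average `f_Q = |Q|⁻¹ ∫_Q f`. -/
def avg (d : ℕ) (f : Euc d → ℝ) (Q : Set (Euc d)) : ℝ :=
  (volume Q).toReal⁻¹ * ∫ x in Q, f x

/-- The Euclidean norm is at most the `ℓ¹` norm. -/
lemma EuclideanSpace.norm_le_sum {d : ℕ} (x : Euc d) : ‖x‖ ≤ ∑ i, |x i| := by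
  rw [EuclideanSpace.norm_eq]
  refine Real.sqrt_le_iff.2 ⟨Finset.sum_nonneg fun _ _ => abs_nonneg _, ?_⟩
  simp only [Real.norm_eq_abs]
  exact Finset.sum_sq_le_sq_sum_of_nonneg fun _ _ => abs_nonneg _

/-- A set symmetric about `a` has barycenter `a`. -/
lemma cubeCenter_eq_of_symmetric {d : ℕ} {Q : Set (Euc d)} {a : Euc d}
    (hQ : MeasurableSet Q) (hb : Bornology.IsBounded Q) (h0 : volume Q ≠ 0)
    (hsymm : (fun x => (2 : ℝ) • a - x) ⁻¹' Q = Q) : cubeCenter d Q = a := by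
  have hfin : volume Q ≠ ⊤ := hb.measure_lt_top.ne
  have hint : IntegrableOn (fun x : Euc d => x) Q := by
    obtain ⟨R, hR⟩ := hb.exists_norm_le
    exact Measure.integrableOn_of_bounded hfin aestronglyMeasurable_id (M := R)
      ((ae_restrict_iff' hQ).2 (Eventually.of_forall hR))
  have := isFiniteMeasure_restrict.2 hfin
  have hpres : MeasurePreserving (fun x : Euc d => (2 : ℝ) • a - x) volume volume :=
    Measure.measurePreserving_sub_left volume _
  have hemb : MeasurableEmbedding (fun x : Euc d => (2 : ℝ) • a - x) :=
    (MeasurableEquiv.subLeft ((2 : ℝ) • a)).measurableEmbedding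
  have hrefl := hpres.setIntegral_preimage_emb hemb (fun x => x) Q
  rw [hsymm, integral_sub (integrable_const _) hint, setIntegral_const] at hrefl
  have hpos : (volume Q).toReal ≠ 0 := ENNReal.toReal_ne_zero.2 ⟨h0, hfin⟩
  have hval : ∫ x in Q, x = (volume Q).toReal • a := by
    have h2 : (2 : ℝ) • ∫ x in Q, x = (2 : ℝ) • ((volume Q).toReal • a) := by
      rw [two_smul ℝ (∫ x in Q, x)]
      nth_rewrite 1 [← hrefl]
      rw [sub_add_cancel, smul_comm]
      rfl
    exact smul_right_injective _ (two_ne_zero (α := ℝ)) h2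
  rw [cubeCenter, hval, smul_smul, inv_mul_cancel₀ hpos, one_smul]

/-- A cube in coordinates centered at its barycenter. -/
lemma IsCube.exists_eq_image {d : ℕ} {Q : Set (Euc d)} (h : IsCube d Q) :
    ∃ (l : ℝ) (r : Euc d ≃ₗᵢ[ℝ] Euc d), 0 < l ∧
      Q = {y | ∀ i, |r.symm (y - cubeCenter d Q) i| < l / 2} := by
  obtain ⟨l, hl, r, v, hQ⟩ := h
  set m : Euc d := WithLp.toLp 2 fun _ => (1 / 2 : ℝ)
  set a : Euc d := l • r m + v
  have hQa : Q = {y | ∀ i, |r.symm (y - a) i| < l / 2} := by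
    rw [hQ]
    ext y
    simp only [mem_image, mem_ofPred_eq, mem_Ioo]
    constructor
    · rintro ⟨x, hx, rfl⟩ i
      have hsub : l • r x + v - a = r (l • (x - m)) := by
        simp only [a, map_smul, map_sub, smul_sub]; abel
      rw [hsub, r.symm_apply_apply]
      have hcoord : (l • (x - m)) i = l * (x i - 1 / 2) := by simp [m]
      rw [hcoord, abs_lt]
      constructor <;> nlinarith [hx i]
    · intro hy
      refine ⟨l⁻¹ • r.symm (y - a) + m, fun i => ?_, ?_⟩
      · have hcoord : (l⁻¹ • r.symm (y - a) + m) i = l⁻¹ * r.symm (y - a) i + 1 / 2 := by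
          simp [m]
        have hi := abs_lt.1 (hy i)
        have hcancel : l * (l⁻¹ * r.symm (y - a) i) = r.symm (y - a) i :=
          mul_inv_cancel_left₀ hl.ne' _
        rw [hcoord]
        constructor <;> nlinarith
      · rw [map_add, map_smul, r.apply_symm_apply, smul_add, smul_smul,
          mul_inv_cancel₀ hl.ne', one_smul]
        simp only [a]; abel
  have hopen : IsOpen Q := by
    rw [hQa, ofPred_forall]
    exact isOpen_iInter_of_finite fun i => isOpen_lt (by fun_prop) continuous_const
  have hmem : a ∈ Q := by rw [hQa]; simp [hl]
  have hb : Bornology.IsBounded Q := by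
    refine (isBounded_iff_subset_closedBall a).2 ⟨∑ _i : Fin d, l / 2, fun y hy => ?_⟩
    rw [hQa] at hy
    rw [mem_closedBall, dist_eq_norm, ← r.symm.norm_map]
    exact (EuclideanSpace.norm_le_sum _).trans (Finset.sum_le_sum fun i _ => (hy i).le)
  have hcenter : cubeCenter d Q = a := by
    refine cubeCenter_eq_of_symmetric hopen.measurableSet hb
      (hopen.measure_pos volume ⟨a, hmem⟩).ne' ?_
    rw [hQa]
    ext y
    have hneg : (2 : ℝ) • a - y - a = -(y - a) := by rw [two_smul]; abel
    simp only [mem_preimage, mem_ofPred_eq, hneg, map_neg, PiLp.neg_apply, abs_neg]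
  exact ⟨l, r, hl, by rw [hcenter]; exact hQa⟩

/-- Comparison of a cube and its dilates with balls. -/
lemma IsCube.exists_bounds {d : ℕ} {Q : Set (Euc d)} (h : IsCube d Q) :
    ∃ l : ℝ, 0 < l ∧ Q ⊆ closedBall (cubeCenter d Q) (d * l) ∧
      (∀ K : ℝ, 0 < K → ball (cubeCenter d Q) (K * (l / 2)) ⊆ dilate d K Q) ∧
      ∀ s : ℝ, 0 < s → ∀ x ∈ dilate d s Q, ∀ y, dist y x < (1 - s) * (l / 2) → y ∈ Q := by
  obtain ⟨l, r, hl, hQ⟩ := h.exists_eq_image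
  have hcoord : ∀ (z : Euc d) (i : Fin d), |r.symm z i| ≤ ‖z‖ := fun z i => by
    simpa using PiLp.norm_apply_le (r.symm z) i
  set c := cubeCenter d Q
  have hmem : ∀ y, y ∈ Q ↔ ∀ i, |r.symm (y - c) i| < l / 2 := fun y => by
    nth_rewrite 1 [hQ]; rfl
  refine ⟨l, hl, fun y hy => ?_, fun K hK y hy => ?_, fun s hs x hx y hxy => ?_⟩
  · rw [mem_closedBall, dist_eq_norm, ← r.symm.norm_map]
    refine (EuclideanSpace.norm_le_sum _).trans
      ((Finset.sum_le_sum fun i _ => ((hmem y).1 hy i).le.trans (half_le_self hl.le)).trans ?_)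
    simp
  · refine ⟨c + K⁻¹ • (y - c), (hmem _).2 fun i => ?_, ?_⟩
    · rw [add_sub_cancel_left]
      refine (hcoord _ i).trans_lt ?_
      rw [norm_smul, norm_inv, Real.norm_of_nonneg hK.le, inv_mul_lt_iff₀ hK, ← dist_eq_norm]
      exact hy
    · simp [c, smul_smul, hK.ne']
  · obtain ⟨z, hz, rfl⟩ := hx
    refine (hmem y).2 fun i => ?_
    have hsplit : y - c = s • (z - c) + (y - (c + s • (z - c))) := by abel
    rw [hsplit, map_add, map_smul, PiLp.add_apply, PiLp.smul_apply, smul_eq_mul]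
    refine (abs_add_le _ _).trans_lt ?_
    rw [abs_mul, abs_of_pos hs]
    have h1 := mul_le_mul_of_nonneg_left ((hmem z).1 hz i).le hs.le
    have h2 := (hcoord (y - (c + s • (z - c))) i).trans_lt (by rwa [← dist_eq_norm])
    linarith

/-- given a finite set `S` of cubes and, for each `Q0 ∈ S`, a set `D(Q0)`
of cubes contained in `Q0`, with `𝒟 = ⋃_{Q0∈S} D(Q0)`, such that no cube of `S` is
strictly contained in a cube of `𝒟`, for every `ε ∈ (0,1)` there are constants
`C, C₁, C₂` (depending only on `ε` and `d`) and a subset `F ⊆ 𝒟` such that: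
(i) every point lies in `(1−ε)²Q` for at most `C` cubes `Q ∈ F`;
(ii) for every `Q0 ∈ S` and `Q ∈ D(Q0)` there is `P ∈ F` with `Q ⊆ C₁P` and `P ⊆ C₂Q0`. -/
theorem stmt14 (d : ℕ) (hd : 1 ≤ d) (ε : ℝ) (hε : ε ∈ Set.Ioo (0:ℝ) 1) :
    ∃ (C : ℕ) (C₁ C₂ : ℝ), 0 < C₁ ∧ 0 < C₂ ∧
      ∀ (S : Finset (Set (Euc d))) (D : Set (Euc d) → Set (Set (Euc d))),
        (∀ Q0 ∈ S, IsCube d Q0) →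
        (∀ Q0 ∈ S, ∀ Q ∈ D Q0, IsCube d Q ∧ Q ⊆ Q0) →
        (∀ Q0 ∈ S, ∀ P ∈ ⋃ Q1 ∈ S, D Q1, ¬ Q0 ⊂ P) →
        ∃ F : Set (Set (Euc d)), F ⊆ (⋃ Q1 ∈ S, D Q1) ∧
          (∀ x : Euc d,
            {Q | Q ∈ F ∧ x ∈ dilate d ((1-ε)^2) Q}.Finite ∧
            Nat.card {Q | Q ∈ F ∧ x ∈ dilate d ((1-ε)^2) Q} ≤ C) ∧
          (∀ Q0 ∈ S, ∀ Q ∈ D Q0, ∃ P ∈ F,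
            Q ⊆ dilate d C₁ P ∧ P ⊆ dilate d C₂ Q0) := by
  obtain ⟨hε0, hε1⟩ := hε
  have hs0 : 0 < (1 - ε) ^ 2 := by have := sub_pos.2 hε1; positivity
  have hs1 : (1 - ε) ^ 2 < 1 := by nlinarith
  generalize (1 - ε) ^ 2 = s at hs0 hs1
  have hd1 : (1 : ℝ) ≤ d := by exact_mod_cast hd
  have hs : 0 < 1 - s := sub_pos.2 hs1
  refine ⟨1, 12 * d, 16 * d ^ 2 / (1 - s) + 3 * d, by positivity, by positivity,
    fun S D hS hD hSD => ?_⟩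
  have hcube : ∀ Q ∈ ⋃ Q1 ∈ S, D Q1, IsCube d Q := fun Q hQ => by
    obtain ⟨Q0, hQ0, hQ⟩ := mem_iUnion₂.1 hQ
    exact (hD Q0 hQ0 Q hQ).1
  have hbdd : ∀ Q, IsCube d Q → Bornology.IsBounded Q := fun Q hQ => by
    obtain ⟨l, -, hsub, -⟩ := hQ.exists_bounds
    exact isBounded_closedBall.subset hsub
  have hdiam : ∀ Q ∈ ⋃ Q1 ∈ S, D Q1, diam Q ≤ ∑ Q0 ∈ S, diam Q0 := fun Q hQ => by
    obtain ⟨Q0, hQ0, hQ⟩ := mem_iUnion₂.1 hQ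
    exact (diam_mono (hD Q0 hQ0 Q hQ).2 (hbdd Q0 (hS Q0 hQ0))).trans
      (Finset.single_le_sum (f := diam) (fun _ _ => diam_nonneg) hQ0)
  have hne : ∀ Q ∈ ⋃ Q1 ∈ S, D Q1, (dilate d s Q).Nonempty := fun Q hQ => by
    obtain ⟨l, hl, -, hball, -⟩ := (hcube Q hQ).exists_bounds
    exact ⟨_, hball s hs0 (mem_ball_self (by positivity))⟩
  obtain ⟨F, hF, hdisj, hcover⟩ := Vitali.exists_disjoint_subfamily_covering_enlargement
    (dilate d s) (⋃ Q1 ∈ S, D Q1) diam 2 one_lt_two (fun _ _ => diam_nonneg) _ hdiam hne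
  refine ⟨F, hF, fun x => ?_, fun Q0 hQ0 Q hQ => ?_⟩
  · have hsub : {Q | Q ∈ F ∧ x ∈ dilate d s Q}.Subsingleton := fun P hP Q hQ =>
      hdisj.elim_set hP.1 hQ.1 x hP.2 hQ.2
    have := hsub.coe_sort
    exact ⟨hsub.finite, Finite.card_le_one_iff_subsingleton.2 this⟩
  have hQt : Q ∈ ⋃ Q1 ∈ S, D Q1 := mem_iUnion₂.2 ⟨Q0, hQ0, hQ⟩
  obtain ⟨P, hPF, ⟨x, hxQ, hxP⟩, hQP⟩ := hcover Q hQt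
  obtain ⟨l, hl, -, -, hinQ⟩ := (hcube Q hQt).exists_bounds
  obtain ⟨m, hm, hsubP, hballP, hinP⟩ := (hcube P (hF hPF)).exists_bounds
  obtain ⟨l₀, hl₀, hsub₀, hball₀, -⟩ := (hS Q0 hQ0).exists_bounds
  have hx : x ∈ Q := hinQ s hs0 x hxQ x (by rw [dist_self]; positivity)
  have hx' : x ∈ P := hinP s hs0 x hxP x (by rw [dist_self]; positivity)
  have hx₀ : x ∈ Q0 := (hD Q0 hQ0 Q hQ).2 hx
  have hdiamP : diam P ≤ 2 * (d * m) := diam_le_of_subset_closedBall (by positivity) hsubP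
  have hdiam₀ : diam Q0 ≤ 2 * (d * l₀) := diam_le_of_subset_closedBall (by positivity) hsub₀
  refine ⟨P, hPF, fun y hy => hballP _ (by positivity) ?_, fun y hy =>
    hball₀ _ (by positivity) ?_⟩
  · have h1 := dist_le_diam_of_mem (hbdd Q (hcube Q hQt)) hy hx
    have h2 := mem_closedBall.1 (hsubP hx')
    have h3 := dist_triangle y x (cubeCenter d P)
    have h4 : 0 < d * m := by positivity
    rw [mem_ball]
    linarith
  · have h5 : 0 < d * l₀ := by positivity
    have h6 : 0 ≤ d ^ 2 / (1 - s) * l₀ := by positivity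
    have hC₂ : (16 * d ^ 2 / (1 - s) + 3 * d) * (l₀ / 2) =
      8 * (d ^ 2 / (1 - s) * l₀) + 3 / 2 * (d * l₀) := by ring
    rw [mem_ball, hC₂]
    rcases eq_or_ne Q0 P with rfl | hne
    · have := mem_closedBall.1 (hsub₀ hy)
      linarith
    have hside : (1 - s) * (m / 2) ≤ 2 * (d * l₀) := by
      by_contra! hlt
      refine hSD Q0 hQ0 P (hF hPF) (LE.le.ssubset_of_ne (fun z hz => ?_) hne)
      exact hinP s hs0 x hxP z
        ((dist_le_diam_of_mem (hbdd Q0 (hS Q0 hQ0)) hz hx₀).trans_lt (hdiam₀.trans_lt hlt))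
    have hm' : d * m ≤ 4 * (d ^ 2 / (1 - s) * l₀) := by
      have : m ≤ 4 * (d * l₀) / (1 - s) := by
        rw [le_div_iff₀ hs]
        linarith
      calc (d : ℝ) * m ≤ d * (4 * (d * l₀) / (1 - s)) := by gcongr
        _ = _ := by ring
    have h1 := dist_le_diam_of_mem (hbdd P (hcube P (hF hPF))) hy hx'
    have h2 := mem_closedBall.1 (hsub₀ hx₀)
    have h3 := dist_triangle y x (cubeCenter d Q0)
    linarith
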